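/- For all n ≥ 1, the number of maximal chains of length n−1 in the Tamari lattice T_n is #C_{−1}(n) = 1, and the number of maximal chains of length n in T_n is #C_0(n) = C(n,3). -/

import Mathlib

/-!
Common definitions for formalizing "A recursion on maximal chains in the Tamari lattices"
(L. Nelson).

* Young diagrams are encoded by their row-length functions `lam : ℕ → ℕ` (rows indexed from 1,
  with `lam 0 = 0`).
* Dyck paths are lists of steps (north/east).
* Tableaux are encoded by entry functions `f : ℕ × ℕ → ℕ` (1-indexed boxes; value `0` means
  "no box").  The label of box `(x, y)` is `f (x, y)`.
-/

noncomputable section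

namespace TamariMaxChains

/-- A step of a lattice path: north or east. -/
inductive Step : Type
  | N : Step
  | E : Step
deriving DecidableEq

/-- Number of north steps of a path. -/
def nCount (p : List Step) : ℕ := p.count Step.N

/-- Number of east steps of a path. -/
def eCount (p : List Step) : ℕ := p.count Step.E

/-- `p` is a Dyck path: equally many norths and easts, and every prefix has at least as many
north steps as east steps (the path never goes below the diagonal `y = x`). -/
def IsDyck (p : List Step) : Prop :=
  nCount p = eCount p ∧ ∀ q : List Step, q <+: p → eCount q ≤ nCount q

/-- `q` is a prime Dyck path: it meets the slope-one line joining its endpoints only at its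
endpoints. -/
def IsPrimeDyck (q : List Step) : Prop :=
  q ≠ [] ∧ nCount q = eCount q ∧
    ∀ s : List Step, s <+: q → s ≠ [] → s ≠ q → eCount s < nCount s

/-- Covering relation of the Tamari lattice on Dyck paths:  `TamariCoverD P' P` means `P'`
covers `P`, i.e. `P'` is obtained from `P` by swapping an east step that is followed by a north
step with the prime Dyck subpath following it. -/
def TamariCoverD (P' P : List Step) : Prop :=
  ∃ a q b : List Step, IsPrimeDyck q ∧
    P = a ++ Step.E :: (q ++ b) ∧ P' = a ++ (q ++ Step.E :: b)

/-- `lam` is the row-length function of a Young diagram: rows are indexed from `1`,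
`lam x` is the number of boxes in row `x`, rows weakly decrease, finitely many boxes. -/
def IsDiagram (lam : ℕ → ℕ) : Prop :=
  lam 0 = 0 ∧ (∀ x, 1 ≤ x → lam (x + 1) ≤ lam x) ∧ ∃ N, ∀ x, N ≤ x → lam x = 0

/-- The height (number of north steps) of the prime path of row `d ≥ 1` of the Young diagram
with row lengths `lam`:  the least `t ≥ 1` such that either `t = d` (row `0` being regarded as
an infinite row of boxes) or row `d - t` has length at least `lam d + t`. -/
def primeHeight (lam : ℕ → ℕ) (d : ℕ) : ℕ :=
  sInf {t | 1 ≤ t ∧ (t = d ∨ (t < d ∧ lam d + t ≤ lam (d - t)))}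

/-- The last box of row `d` is a corner box (last box of its row and lowest box of
its column). -/
def IsCorner (lam : ℕ → ℕ) (d : ℕ) : Prop := 1 ≤ d ∧ 1 ≤ lam d ∧ lam (d + 1) < lam d

/-- The result of removing the `B`-strip of the last box `B` of row `d`: the last box of each of
the rows `d - h + 1, …, d` is removed, where `h` is the height of the prime path of row `d`. -/
def removeStrip (lam : ℕ → ℕ) (d : ℕ) : ℕ → ℕ := fun x =>
  if d + 1 ≤ x + primeHeight lam d ∧ x ≤ d then lam x - 1 else lam x

/-- Covering relation of the Tamari lattice on Young diagrams:  `mu` covers `lam` iff `mu` is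
obtained from `lam` by removing the `B`-strip of a corner box `B`. -/
def TamariCoverY (mu lam : ℕ → ℕ) : Prop := ∃ d, IsCorner lam d ∧ mu = removeStrip lam d

/-- The `B`-strip of the last box `B` of row `d`: the set of last boxes of rows
`d - h + 1, …, d`, where `h` is the height of the prime path of row `d`. -/
def stripSet (lam : ℕ → ℕ) (d : ℕ) : Set (ℕ × ℕ) :=
  {b | b.2 = lam b.1 ∧ 1 ≤ b.2 ∧ d + 1 ≤ b.1 + primeHeight lam d ∧ b.1 ≤ d}

/-- The enclosure of the `B`-strip of the last box `B = (d, lam d)` of row `d`: all boxes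
`(x, y)` with `d - h ≤ x ≤ d` and `lam d ≤ y ≤ lam d + h`, where row `0` is regarded as an
infinite row of boxes. -/
def enclosure (lam : ℕ → ℕ) (d : ℕ) : Set (ℕ × ℕ) :=
  {b | (b.1 = 0 ∨ b.2 ≤ lam b.1) ∧ 1 ≤ b.2 ∧
    d ≤ b.1 + primeHeight lam d ∧ b.1 ≤ d ∧ lam d ≤ b.2 ∧ b.2 ≤ lam d + primeHeight lam d}

/-- The Dyck path of length `2 n` corresponding to the Young diagram `lam` contained in the
staircase `δ_{n-1}` (the Dyck path is the silhouette of the Young diagram). -/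
def toDyck (n : ℕ) (lam : ℕ → ℕ) : List Step :=
  ((List.range n).flatMap fun k =>
    List.replicate (lam (n - k) - lam (n - k + 1)) Step.E ++ [Step.N]) ++
    List.replicate (n - lam 1) Step.E

/-- The prime path of row `d` of the Young diagram `lam`, as its list of steps (read from its
lower-left endpoint). -/
def primePathList (lam : ℕ → ℕ) (d : ℕ) : List Step :=
  Step.N :: ((((List.range (primeHeight lam d - 1)).flatMap fun j =>
    List.replicate (lam (d - 1 - j) - lam (d - j)) Step.E ++ [Step.N])) ++
    List.replicate (lam d + primeHeight lam d - lam (d - (primeHeight lam d - 1))) Step.E)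

/-- `S` translates to `S'` by `p` units down and `q` units to the right. -/
def TranslatesBy (p q : ℤ) (S S' : Set (ℕ × ℕ)) : Prop :=
  ∀ x y : ℕ, (x, y) ∈ S' ↔ ∃ a b : ℕ, (a, b) ∈ S ∧ (x : ℤ) = a + p ∧ (y : ℤ) = b + q

/-- `S` translates to `S'`. -/
def Translates (S S' : Set (ℕ × ℕ)) : Prop := ∃ p q : ℤ, TranslatesBy p q S S'

/-- The length of a tableau: its number of distinct labels (for an honest tableau, labels are
exactly `1, …, tlen f`). -/
def tlen (f : ℕ × ℕ → ℕ) : ℕ := sSup {v | v ≠ 0 ∧ ∃ b, f b = v}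

/-- The number of boxes in row `x` of a tableau. -/
def rowLen (f : ℕ × ℕ → ℕ) (x : ℕ) : ℕ := sSup {y | f (x, y) ≠ 0}

/-- The number of boxes in column `y` of a tableau. -/
def colLen (f : ℕ × ℕ → ℕ) (y : ℕ) : ℕ := sSup {x | f (x, y) ≠ 0}

/-- `f` is (the entry function of) a tableau: the support is a Young diagram (1-indexed),
rows strictly increase, columns weakly increase, and the set of labels is exactly
`{1, …, tlen f}`. -/
def IsTableau (f : ℕ × ℕ → ℕ) : Prop :=
  (∀ y, f (0, y) = 0) ∧ (∀ x, f (x, 0) = 0) ∧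
  {b : ℕ × ℕ | f b ≠ 0}.Finite ∧
  (∀ x y x' y', 1 ≤ x' → x' ≤ x → 1 ≤ y' → y' ≤ y → f (x, y) ≠ 0 → f (x', y') ≠ 0) ∧
  (∀ x y, f (x, y) ≠ 0 → f (x, y + 1) ≠ 0 → f (x, y) < f (x, y + 1)) ∧
  (∀ x y, f (x, y) ≠ 0 → f (x + 1, y) ≠ 0 → f (x, y) ≤ f (x + 1, y)) ∧
  (∀ v, 1 ≤ v → (v ≤ tlen f ↔ ∃ b, f b = v))

/-- `T^(r)`: the subtableau of all entries at most `r`. -/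
def trunc (f : ℕ × ℕ → ℕ) (r : ℕ) : ℕ × ℕ → ℕ := fun b => if f b ≤ r then f b else 0

/-- The shape (row-length function) of a tableau. -/
def shapeOf (f : ℕ × ℕ → ℕ) : ℕ → ℕ := fun x => rowLen f x

/-- The row index of the end-box of the `k`-set of `f` (the maximal row index of a box
labeled `k`). -/
def endRow (f : ℕ × ℕ → ℕ) (k : ℕ) : ℕ := sSup {x | ∃ y, f (x, y) = k}

/-- `Y 0 ⋗ Y 1 ⋗ ⋯ ⋗ Y l` is a saturated chain in the Tamari order on Young diagrams whose
maximal element `Y 0` is the empty diagram (each `Y r` covers `Y (r+1)`). -/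
def IsTamariChain (Y : ℕ → ℕ → ℕ) (l : ℕ) : Prop :=
  (∀ r, r ≤ l → IsDiagram (Y r)) ∧ (∀ x, Y 0 x = 0) ∧
    ∀ r, r < l → TamariCoverY (Y r) (Y (r + 1))

/-- The tableau `ψ(C)` of the saturated chain `C = (∅ = Y 0 ⋗ ⋯ ⋗ Y l)`: the boxes removed in
the transition `Y (r-1) ⋗ Y r` are labeled `r`; that is, each box of `Y l` is labeled by the
least `r` such that the box belongs to `Y r`. -/
def psiFun (Y : ℕ → ℕ → ℕ) (l : ℕ) : ℕ × ℕ → ℕ := fun b =>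
  if 1 ≤ b.1 ∧ 1 ≤ b.2 ∧ b.2 ≤ Y l b.1 then sInf {r | r ≤ l ∧ b.2 ≤ Y r b.1} else 0

/-- `f` is a `ψ`-tableau: it is in the image of `ψ`. -/
def IsPsiTab (f : ℕ × ℕ → ℕ) : Prop :=
  ∃ l Y, IsTamariChain Y l ∧ f = psiFun Y l

/-- Row lengths of the staircase shape `δ_{n-1} = (n-1, n-2, …, 1)`: row `x ≥ 1` has `n - x`
boxes. -/
def dstair (n : ℕ) : ℕ → ℕ := fun x => if x = 0 then 0 else n - x

/-- `C_i(n)`, via `ψ`: the set of maximal chains of length `n + i` in the Tamari lattice `T_n`,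
identified with the `ψ`-tableaux of length `n + i` and shape `δ_{n-1}`. -/
def MemC (i : ℤ) (n : ℕ) (f : ℕ × ℕ → ℕ) : Prop :=
  IsTableau f ∧ IsPsiTab f ∧ (∀ x, rowLen f x = dstair n x) ∧ (tlen f : ℤ) = (n : ℤ) + i

/-- The `r`-set of `f` (of shape `δ_{n-1}`) is a full-set with end-box `(k, n - k)`:
it begins in row `1` and ends in the outer diagonal, at the box `(k, n - k)`. -/
def HasFullSetAt (f : ℕ × ℕ → ℕ) (n r k : ℕ) : Prop :=
  (∃ y, f (1, y) = r) ∧ 1 ≤ k ∧ k ≤ n - 1 ∧ f (k, n - k) = r ∧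
    ∀ x y, f (x, y) = r → x ≤ k

/-- `f` has an `r`-full-set. -/
def HasFullSet (f : ℕ × ℕ → ℕ) (n r : ℕ) : Prop := ∃ k, HasFullSetAt f n r k

/-- `f` has an `r⁺`-full-set (plus-full-set): an `r`-full-set whose end-box `(k, n-k)` satisfies
`k = n - 1`, or `k ≤ n - 2` and the southwest neighbor has a smaller label. -/
def HasPlusFullSet (f : ℕ × ℕ → ℕ) (n r : ℕ) : Prop :=
  ∃ k, HasFullSetAt f n r k ∧ (k = n - 1 ∨ (k ≤ n - 2 ∧ f (k + 1, n - k - 1) < r))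

/-- `F_i^r(n)`: the set of `C ∈ C_i(n)` whose `r`-set is a plus-full-set and whose `j`-set is
not a plus-full-set for any `j ∈ [r-1]`. -/
def MemF (i : ℤ) (n : ℕ) (r : ℕ) (f : ℕ × ℕ → ℕ) : Prop :=
  MemC i n f ∧ HasPlusFullSet f n r ∧ ∀ j, 1 ≤ j → j < r → ¬ HasPlusFullSet f n j

/-- `N_i(n)`: the set of `C ∈ C_i(n)` having no plus-full-sets. -/
def MemN (i : ℤ) (n : ℕ) (f : ℕ × ℕ → ℕ) : Prop :=
  MemC i n f ∧ ∀ r, ¬ HasPlusFullSet f n r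

/-- `α_d`: shift all rows of index greater than `d` down one row and repeat row `d` in
row `d + 1`. -/
def alphaFun (d : ℕ) (f : ℕ × ℕ → ℕ) : ℕ × ℕ → ℕ := fun b =>
  if b.1 ≤ d then f b else f (b.1 - 1, b.2)

/-- `β_d`: append a box labeled `tlen f + 1` at the end of each of the rows `1, …, d`. -/
def betaFun (d : ℕ) (f : ℕ × ℕ → ℕ) : ℕ × ℕ → ℕ := fun b =>
  if 1 ≤ b.1 ∧ b.1 ≤ d ∧ b.2 = rowLen f b.1 + 1 then tlen f + 1 else f b

/-- The number of boxes of row `x` of `f` whose label is at most `r` (these occupy an initial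
segment of the row). -/
def lowLen (f : ℕ × ℕ → ℕ) (r x : ℕ) : ℕ := sSup {y | f (x, y) ≠ 0 ∧ f (x, y) ≤ r}

/-- The row index `d` used in the definition of `Ĉ(r)`: the minimal `k ∈ [n-1]` with
`C (k, n-k) ≤ r` if such `k` exists, and `n` otherwise. -/
def hatD (f : ℕ × ℕ → ℕ) (n r : ℕ) : ℕ :=
  sInf ({k | 1 ≤ k ∧ k ≤ n - 1 ∧ 1 ≤ f (k, n - k) ∧ f (k, n - k) ≤ r} ∪ {n})

/-- `Ĉ(r)` for `C ∈ C_i(n)` and `0 ≤ r ≤ n + i`: starting from `β_d(α_d(C^(r)))` (where `d` is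
as in `hatD`), the entries of `C` greater than `r` of row index less than `d` are translated one
unit to the right, those of row index greater than `d` are translated one unit down, and all
these labels are incremented by one. -/
def hatFun (f : ℕ × ℕ → ℕ) (n r : ℕ) : ℕ × ℕ → ℕ := fun b =>
  let d := hatD f n r
  let x := b.1
  let y := b.2
  if x = 0 ∨ y = 0 then 0
  else if x ≤ d then
    if f (x, y) ≠ 0 ∧ f (x, y) ≤ r then f (x, y)
    else if y = lowLen f r x + 1 then r + 1
    else if r < f (x, y - 1) then f (x, y - 1) + 1
    else 0
  else if x = d + 1 then f (d, y)
  else if f (x - 1, y) = 0 then 0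
  else if f (x - 1, y) ≤ r then f (x - 1, y)
  else f (x - 1, y) + 1

/-- `RepBy i m t r C0 C` : `C = (φ_{i,m+t-1}^{r 1} ∘ φ_{i,m+t-2}^{r 2} ∘ ⋯ ∘ φ_{i,m}^{r t}) C0`,
each factor being applied within its domain. -/
def RepBy (i : ℤ) (m t : ℕ) (r : ℕ → ℕ) (C0 C : ℕ × ℕ → ℕ) : Prop :=
  ∃ D : ℕ → ℕ × ℕ → ℕ, D 0 = C0 ∧ D t = C ∧
    ∀ s, s < t →
      MemC i (m + s) (D s) ∧
      ((r (t - s) : ℤ) ≤ (m : ℤ) + s + i) ∧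
      (∀ j, 1 ≤ j → j ≤ r (t - s) → ¬ HasPlusFullSet (D s) (m + s) j) ∧
      D (s + 1) = hatFun (D s) (m + s) (r (t - s))

/-- The set `𝕏_{d,n-1}^r` of Theorem 4.3: `ψ`-tableaux of length `r`, contained in `δ_{n-1}`,
whose row `d` has length `n - d` and whose prime path of row `d` has height `d`. -/
def MemX (d n r : ℕ) (f : ℕ × ℕ → ℕ) : Prop :=
  IsTableau f ∧ IsPsiTab f ∧ tlen f = r ∧
    (∀ x, 1 ≤ x → rowLen f x ≤ n - x) ∧
    rowLen f d = n - d ∧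
    primeHeight (shapeOf f) d = d

/-- The set `ℤ_{d,n}^{r+1}` of Theorem 4.3: `ψ`-tableaux of length `r + 1`, contained in `δ_n`,
such that rows `d` and `d+1` of the truncation at `r` are identical, the end-box of the
`(r+1)`-set is `(d, n-d+1)`, and the prime path of `(d, n-d+1)` has height `d`. -/
def MemZ (d n r : ℕ) (g : ℕ × ℕ → ℕ) : Prop :=
  IsTableau g ∧ IsPsiTab g ∧ tlen g = r + 1 ∧
    (∀ x, 1 ≤ x → rowLen g x ≤ n + 1 - x) ∧
    (∀ y, trunc g r (d, y) = trunc g r (d + 1, y)) ∧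
    g (d, n - d + 1) = r + 1 ∧ (∀ x y, g (x, y) = r + 1 → x ≤ d) ∧
    primeHeight (shapeOf g) d = d

/-! ### The bracket vector of a diagram -/

/-- The row at which the prime path of row `z` ends. -/
def G (lam : ℕ → ℕ) (z : ℕ) : ℕ := z - primeHeight lam z

lemma ph_spec (lam : ℕ → ℕ) {z : ℕ} (hz : 1 ≤ z) :
    1 ≤ primeHeight lam z ∧ (primeHeight lam z = z ∨
      (primeHeight lam z < z ∧ lam z + primeHeight lam z ≤ lam (z - primeHeight lam z))) := by
  have h : ({t | 1 ≤ t ∧ (t = z ∨ (t < z ∧ lam z + t ≤ lam (z - t)))} : Set ℕ).Nonempty :=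
    ⟨z, hz, Or.inl rfl⟩
  exact Nat.sInf_mem h

lemma ph_le (lam : ℕ → ℕ) {z : ℕ} (hz : 1 ≤ z) : primeHeight lam z ≤ z := by
  have := ph_spec lam hz
  omega

lemma ph_min (lam : ℕ → ℕ) {z t : ℕ} (ht : 1 ≤ t) (h1 : t < z) (h2 : lam z + t ≤ lam (z - t)) :
    primeHeight lam z ≤ t := Nat.sInf_le ⟨ht, Or.inr ⟨h1, h2⟩⟩

/-- `e` is the previous greater-or-equal position of `z` for `x ↦ lam x + x`. -/
def IsPrev (lam : ℕ → ℕ) (z e : ℕ) : Prop :=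
  e < z ∧ (e = 0 ∨ lam z + z ≤ lam e + e) ∧ ∀ k, e < k → k < z → lam k + k < lam z + z

lemma G_spec (lam : ℕ → ℕ) {z : ℕ} (hz : 1 ≤ z) : IsPrev lam z (G lam z) := by
  have h := ph_spec lam hz
  have hl := ph_le lam hz
  unfold G
  refine ⟨by omega, ?_, ?_⟩
  · rcases h with ⟨h1, h2 | ⟨h2, h3⟩⟩
    · left; omega
    · right; omega
  · intro k hk1 hk2
    by_contra hcon
    have := ph_min lam (z := z) (t := z - k) (by omega) (by omega) (by
      rw [show z - (z - k) = k by omega]; omega)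
    omega

lemma prev_unique {lam : ℕ → ℕ} {z e e' : ℕ} (h : IsPrev lam z e) (h' : IsPrev lam z e') :
    e = e' := by
  obtain ⟨a, b, c⟩ := h
  obtain ⟨a', b', c'⟩ := h'
  rcases lt_trichotomy e e' with hlt | heq | hgt
  · have := c e' hlt a'
    omega
  · exact heq
  · have := c' e hgt a
    omega

lemma G_eq {lam : ℕ → ℕ} {z e : ℕ} (h : IsPrev lam z e) : G lam z = e :=
  prev_unique (G_spec lam (by have := h.1; omega)) h

lemma G_zero (lam : ℕ → ℕ) : G lam 0 = 0 := by simp [G]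

lemma removeStrip_eq (lam : ℕ → ℕ) {d : ℕ} (hd : 1 ≤ d) (x : ℕ) :
    removeStrip lam d x = if G lam d < x ∧ x ≤ d then lam x - 1 else lam x := by
  unfold removeStrip G
  have := ph_le lam hd
  congr 1
  apply propext
  constructor <;> rintro ⟨h1, h2⟩ <;> exact ⟨by omega, h2⟩

lemma diag_pos {lam : ℕ → ℕ} (h : IsDiagram lam) {d x : ℕ} (hx : 1 ≤ x) (hxd : x ≤ d) :
    lam d ≤ lam x := by
  induction d, hxd using Nat.le_induction with
  | base => exact le_rfl
  | succ k hk ih => exact (h.2.1 k (by omega)).trans ih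

lemma removeStrip_diag {lam : ℕ → ℕ} (h : IsDiagram lam) {d : ℕ} (hc : IsCorner lam d) :
    IsDiagram (removeStrip lam d) := by
  obtain ⟨hd, hc1, hc2⟩ := hc
  have hg := G_spec lam hd
  refine ⟨?_, ?_, ?_⟩
  · rw [removeStrip_eq _ hd, h.1]; simp
  · intro x hx
    rw [removeStrip_eq _ hd, removeStrip_eq _ hd]
    have h1 := h.2.1 x hx
    have h2 : x = d → lam (x + 1) < lam x := by rintro rfl; exact hc2
    have h3 : x ≤ d → lam d ≤ lam x := fun hxd => diag_pos h hx hxd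
    have h4 : x + 1 ≤ d → lam d ≤ lam (x + 1) := fun hxd => diag_pos h (by omega) hxd
    split_ifs <;> omega
  · obtain ⟨N, hN⟩ := h.2.2
    refine ⟨N, fun x hx => ?_⟩
    rw [removeStrip_eq _ hd, hN x hx]; simp

/-- Effect of a removal on the bracket vector. -/
lemma effect {lam : ℕ → ℕ} (h : IsDiagram lam) {d : ℕ} (hc : IsCorner lam d) :
    ∃ z, d < z ∧ G lam z = d ∧ (∀ y, z < y → G lam y ≠ d) ∧
      G (removeStrip lam d) = Function.update (G lam) z (G lam d) := by
  obtain ⟨hd, hc1, hc2⟩ := hc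
  have hg := G_spec lam hd
  set g := G lam d with hgdef
  have hex : ∃ z, d < z ∧ lam d + d ≤ lam z + z := ⟨lam d + d + 1, by omega, by omega⟩
  classical
  obtain ⟨z, ⟨hdz, hmz⟩, hmin⟩ : ∃ z, (d < z ∧ lam d + d ≤ lam z + z) ∧
      ∀ k, k < z → ¬ (d < k ∧ lam d + d ≤ lam k + k) :=
    ⟨Nat.find hex, Nat.find_spec hex, fun k hk => Nat.find_min hex hk⟩
  have hbet : ∀ k, d < k → k < z → lam k + k < lam d + d := by
    intro k h1 h2
    have := hmin k h2
    by_contra hcon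
    exact this ⟨h1, by omega⟩
  have hmz' : lam z + z = lam d + d := by
    have h1 := h.2.1 (z - 1) (by omega)
    rw [show z - 1 + 1 = z by omega] at h1
    by_cases hzd : z = d + 1
    · rw [hzd] at hmz ⊢; omega
    · have := hbet (z - 1) (by omega) (by omega)
      omega
  have hGz : IsPrev lam z d := ⟨hdz, Or.inr (by omega), fun k h1 h2 => by
    have := hbet k h1 h2; omega⟩
  have hle : ∀ k, g < k → k ≤ d → lam k + k ≤ lam d + d := by
    intro k h1 h2
    rcases h2.lt_or_eq with h3 | h3
    · exact (hg.2.2 k h1 h3).le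
    · rw [h3]
  have hpos : ∀ k, g < k → k ≤ d → 1 ≤ lam k := fun k h1 h2 =>
    hc1.trans (diag_pos h (by omega) h2)
  refine ⟨z, hdz, G_eq hGz, ?_, ?_⟩
  · intro y hy hGy
    have := G_spec lam (z := y) (by omega)
    rw [hGy] at this
    have h1 := this.2.2 z hdz hy
    have h2 := this.2.1
    omega
  · have hin : ∀ k, g < k → k ≤ d → removeStrip lam d k = lam k - 1 := fun k h1 h2 => by
      rw [removeStrip_eq _ hd, if_pos ⟨h1, h2⟩]
    have hout : ∀ k, ¬ (g < k ∧ k ≤ d) → removeStrip lam d k = lam k := fun k h1 => by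
      rw [removeStrip_eq _ hd, if_neg h1]
    funext y
    rcases Nat.eq_zero_or_pos y with rfl | hy
    · rw [Function.update_of_ne (by omega), G_zero, G_zero]
    by_cases hyz : y = z
    · rw [hyz, Function.update_self]
      apply G_eq
      refine ⟨by have := hg.1; omega, ?_, ?_⟩
      · rw [hout z (by omega), hout g (by omega)]
        have := hg.2.1; omega
      · intro k h1 h2
        rw [hout z (by omega)]
        by_cases hk : k ≤ d
        · rw [hin k h1 hk]
          have := hle k h1 hk; have := hpos k h1 hk; omega
        · rw [hout k (by omega)]
          have := hbet k (by omega) h2; omega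
    · rw [Function.update_of_ne hyz]
      apply G_eq
      have hy' := G_spec lam hy
      set e := G lam y with he
      obtain ⟨e1, e2, e3⟩ := hy'
      have hge : ¬ (g < g) := lt_irrefl g
      by_cases c1 : y ≤ g
      · refine ⟨e1, ?_, ?_⟩
        · rw [hout y (by omega), hout e (by omega)]; exact e2
        · intro k h1 h2
          rw [hout y (by omega), hout k (by omega)]; exact e3 k h1 h2
      by_cases c2 : y ≤ d
      · have hyle := hle y (by omega) c2
        have hyp := hpos y (by omega) c2
        have heg : g ≤ e := by
          by_contra hcon
          have := e3 g (by omega) (by omega)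
          have := hg.2.1
          omega
        refine ⟨e1, ?_, ?_⟩
        · rw [hin y (by omega) c2]
          by_cases c3 : e = g
          · rw [hout e (by omega)]; omega
          · rw [hin e (by omega) (by omega)]
            have := hpos e (by omega) (by omega); omega
        · intro k h1 h2
          rw [hin y (by omega) c2, hin k (by omega) (by omega)]
          have := e3 k h1 h2; have := hpos k (by omega) (by omega); omega
      by_cases c3 : y < z
      · have hyl := hbet y (by omega) c3
        have hed : d ≤ e := by
          by_contra hcon
          have := e3 d (by omega) (by omega)
          omega
        refine ⟨e1, ?_, ?_⟩
        · rw [hout y (by omega)]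
          by_cases c4 : e = d
          · rw [c4, hin d hg.1 le_rfl]; omega
          · rw [hout e (by omega)]; exact e2
        · intro k h1 h2
          rw [hout y (by omega), hout k (by omega)]; exact e3 k h1 h2
      · have hee : z ≤ e ∨ e ≤ g := by
          by_contra hcon
          have h1 := e3 z (by omega) (by omega)
          by_cases c5 : e ≤ d
          · have := hle e (by omega) c5; omega
          · have := hbet e (by omega) (by omega); omega
        refine ⟨e1, ?_, ?_⟩
        · rw [hout y (by omega), hout e (by omega)]; exact e2
        · intro k h1 h2
          rw [hout y (by omega)]
          have := e3 k h1 h2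
          by_cases c6 : g < k ∧ k ≤ d
          · rw [hin k c6.1 c6.2]; omega
          · rw [hout k c6]; exact this

lemma corner_of_G {lam : ℕ → ℕ} {z : ℕ} (hz : 1 ≤ z) (hg : 1 ≤ G lam z) :
    IsCorner lam (G lam z) := by
  have hs := G_spec lam hz
  set d := G lam z
  obtain ⟨h1, h2, h3⟩ := hs
  have hm : lam (d + 1) < lam d := by
    rcases (show d + 1 ≤ z by omega).lt_or_eq with h4 | h4
    · have := h3 (d + 1) (by omega) h4
      omega
    · rw [h4]; omega
  exact ⟨hg, by omega, hm⟩

/-! ### States, moves and words -/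

/-- The diagram with bracket vector `g`. -/
def lamOf (n : ℕ) (g : ℕ → ℕ) (x : ℕ) : ℕ :=
  if x = 0 then 0 else ∑ y ∈ Finset.range (n + 1), if x ≤ g y then 1 else 0

/-- The move at `z`. -/
def step (g : ℕ → ℕ) (z : ℕ) : ℕ → ℕ := Function.update g z (g (g z))

/-- The move at `z` is allowed. -/
def okMove (g : ℕ → ℕ) (z : ℕ) : Prop := 1 ≤ g z ∧ ∀ y, z < y → g y ≠ g z

/-- `g` is the bracket vector of a diagram. -/
def Good (n : ℕ) (g : ℕ → ℕ) : Prop :=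
  IsDiagram (lamOf n g) ∧ G (lamOf n g) = g ∧ ∀ z, n < z → g z = 0

lemma Good.lt {n : ℕ} {g : ℕ → ℕ} (h : Good n g) {z : ℕ} (hz : 1 ≤ z) : g z < z := by
  have := (G_spec (lamOf n g) hz).1
  rwa [h.2.1] at this

lemma Good.zero {n : ℕ} {g : ℕ → ℕ} (h : Good n g) : g 0 = 0 := by
  have := G_zero (lamOf n g)
  rwa [h.2.1] at this

lemma lamOf_step {n : ℕ} {g : ℕ → ℕ} (h : Good n g) {z : ℕ} (hz : okMove g z) :
    lamOf n (step g z) = removeStrip (lamOf n g) (g z) := by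
  have hzn : z ∈ Finset.range (n + 1) := by
    rw [Finset.mem_range]
    by_contra hcon
    have := h.2.2 z (by omega)
    have := hz.1
    omega
  have hlt := h.lt hz.1
  funext x
  rw [removeStrip_eq _ hz.1, h.2.1]
  rcases Nat.eq_zero_or_pos x with rfl | hx
  · simp [lamOf]
  have e1 : lamOf n g x = (if x ≤ g z then 1 else 0) +
      ∑ y ∈ (Finset.range (n + 1)).erase z, if x ≤ g y then 1 else 0 := by
    rw [lamOf, if_neg (by omega), Finset.add_sum_erase _ (fun y => if x ≤ g y then 1 else 0) hzn]
  have e2 : lamOf n (step g z) x = (if x ≤ g (g z) then 1 else 0) +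
      ∑ y ∈ (Finset.range (n + 1)).erase z, if x ≤ g y then 1 else 0 := by
    rw [lamOf, if_neg (by omega),
      ← Finset.add_sum_erase _ (fun y => if x ≤ step g z y then 1 else 0) hzn]
    congr 1
    · simp [step]
    · apply Finset.sum_congr rfl
      intro y hy
      rw [step, Function.update_of_ne (Finset.ne_of_mem_erase hy)]
  rw [e1, e2]
  split_ifs <;> omega

lemma good_step {n : ℕ} {g : ℕ → ℕ} (h : Good n g) {z : ℕ} (hz : okMove g z) :
    Good n (step g z) ∧ TamariCoverY (lamOf n (step g z)) (lamOf n g) := by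
  have hz1 : 1 ≤ z := by
    rcases Nat.eq_zero_or_pos z with rfl | h1
    · have := h.zero; have := hz.1; omega
    · exact h1
  have hc : IsCorner (lamOf n g) (g z) := by
    have := corner_of_G (lam := lamOf n g) (z := z) hz1 (by rw [h.2.1]; exact hz.1)
    rwa [h.2.1] at this
  have hstep := lamOf_step h hz
  obtain ⟨z', h1, h2, h3, h4⟩ := effect h.1 hc
  rw [h.2.1] at h2 h3 h4
  have hzz : z' = z := by
    rcases lt_trichotomy z z' with hl | hl | hl
    · exact absurd h2 (hz.2 z' hl)
    · exact hl.symm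
    · exact absurd rfl (h3 z hl)
  subst hzz
  refine ⟨⟨?_, ?_, ?_⟩, ⟨g z', hc, hstep⟩⟩
  · rw [hstep]; exact removeStrip_diag h.1 hc
  · rw [hstep, h4]; rfl
  · intro y hy
    rw [step, Function.update_of_ne]
    · exact h.2.2 y hy
    · rintro rfl
      have := h.2.2 y hy
      have := hz.1
      omega

lemma cover_step {n : ℕ} {g mu : ℕ → ℕ} (h : Good n g) (hc : TamariCoverY mu (lamOf n g)) :
    ∃ z, okMove g z ∧ mu = lamOf n (step g z) := by
  obtain ⟨d, hd, rfl⟩ := hc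
  obtain ⟨z, h1, h2, h3, -⟩ := effect h.1 hd
  rw [h.2.1] at h2 h3
  have hok : okMove g z := ⟨by rw [h2]; exact hd.1, fun y hy => by rw [h2]; exact h3 y hy⟩
  exact ⟨z, hok, by rw [lamOf_step h hok, h2]⟩

/-- Initial state. -/
def g0 (n : ℕ) : ℕ → ℕ := fun z => if z ≤ n then z - 1 else 0

lemma lamOf_g0 (n : ℕ) : lamOf n (g0 n) = dstair n := by
  funext x
  unfold lamOf dstair
  split_ifs with hx
  · rfl
  rw [← Finset.card_filter]
  have : (Finset.range (n + 1)).filter (fun y => x ≤ g0 n y) = Finset.Ioc x n := by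
    ext y
    rw [Finset.mem_filter, Finset.mem_range, Finset.mem_Ioc]
    unfold g0
    constructor
    · rintro ⟨h1, h2⟩
      rw [if_pos (by omega)] at h2
      omega
    · rintro ⟨h1, h2⟩
      rw [if_pos (by omega)]
      omega
  rw [this, Nat.card_Ioc]

lemma dstair_diag (n : ℕ) : IsDiagram (dstair n) := by
  refine ⟨by simp [dstair], fun x hx => ?_, n, fun x hx => ?_⟩
  · simp only [dstair]; split_ifs <;> omega
  · simp only [dstair]; split_ifs <;> omega

lemma good_g0 (n : ℕ) : Good n (g0 n) := by
  refine ⟨?_, ?_, ?_⟩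
  · rw [lamOf_g0]; exact dstair_diag n
  · rw [lamOf_g0]
    funext z
    rcases Nat.eq_zero_or_pos z with rfl | hz
    · rw [G_zero]; simp [g0]
    apply G_eq
    unfold g0
    by_cases hzn : z ≤ n
    · rw [if_pos hzn]
      refine ⟨by omega, ?_, fun k h1 h2 => by omega⟩
      simp only [dstair]; split_ifs <;> omega
    · rw [if_neg hzn]
      refine ⟨hz, Or.inl rfl, fun k h1 h2 => ?_⟩
      simp only [dstair]; split_ifs <;> omega
  · intro z hz
    simp only [g0]; rw [if_neg (by omega)]

lemma good_eq_zero {n : ℕ} {g : ℕ → ℕ} (h : Good n g) : (∀ x, lamOf n g x = 0) ↔ g = 0 := by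
  constructor
  · intro h0
    rw [← h.2.1]
    funext z
    rcases Nat.eq_zero_or_pos z with rfl | hz
    · rw [G_zero]; rfl
    apply G_eq
    refine ⟨hz, Or.inl rfl, fun k h1 h2 => ?_⟩
    rw [h0, h0]; omega
  · rintro rfl x
    unfold lamOf
    split_ifs with hx
    · rfl
    · apply Finset.sum_eq_zero
      intro y _
      rw [if_neg]
      simp; omega

/-- Valid words from state `g`. -/
def Valid : (ℕ → ℕ) → List ℕ → Prop
  | g, [] => g = 0
  | g, z :: w => okMove g z ∧ Valid (step g z) w

/-- The chain of diagrams of a word. -/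
def chainOf (n : ℕ) : (ℕ → ℕ) → List ℕ → ℕ → ℕ → ℕ
  | g, [] => fun _ => lamOf n g
  | g, z :: w => fun r => if r ≤ w.length then chainOf n (step g z) w r else lamOf n g

lemma chainOf_end (n : ℕ) (g : ℕ → ℕ) (w : List ℕ) : chainOf n g w w.length = lamOf n g := by
  cases w with
  | nil => rfl
  | cons z w => simp [chainOf]

lemma chainOf_chain {n : ℕ} (w : List ℕ) : ∀ {g : ℕ → ℕ}, Good n g → Valid g w →
    IsTamariChain (chainOf n g w) w.length := by
  induction w with
  | nil =>
    intro g h hv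
    refine ⟨fun r _ => h.1, (good_eq_zero h).2 hv, fun r hr => ?_⟩
    simp at hr
  | cons z w ih =>
    intro g h hv
    obtain ⟨h1, h2⟩ := good_step h hv.1
    have := ih h1 hv.2
    refine ⟨?_, ?_, ?_⟩
    · intro r hr
      by_cases hrw : r ≤ w.length
      · simp only [chainOf, if_pos hrw]; exact this.1 r hrw
      · simp only [chainOf, if_neg hrw]; exact h.1
    · intro x
      simp only [chainOf, if_pos (Nat.zero_le _)]; exact this.2.1 x
    · intro r hr
      simp only [List.length_cons] at hr
      rcases (show r + 1 ≤ w.length ∨ r = w.length by omega) with hr' | hr'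
      · simp only [chainOf, if_pos hr', if_pos (show r ≤ w.length by omega)]
        exact this.2.2 r (by omega)
      · subst hr'
        simp only [chainOf, if_pos le_rfl]
        rw [if_neg (by omega), chainOf_end]
        exact h2

lemma chain_exists {n : ℕ} (l : ℕ) : ∀ {g : ℕ → ℕ} {Y : ℕ → ℕ → ℕ}, Good n g →
    IsTamariChain Y l → Y l = lamOf n g →
    ∃ w : List ℕ, w.length = l ∧ Valid g w ∧ ∀ r, r ≤ l → Y r = chainOf n g w r := by
  induction l with
  | zero =>
    intro g Y h hY he
    refine ⟨[], rfl, ?_, ?_⟩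
    · exact (good_eq_zero h).1 (fun x => by rw [← he]; exact hY.2.1 x)
    · intro r hr
      obtain rfl : r = 0 := by omega
      exact he
  | succ l ih =>
    intro g Y h hY he
    have hcov := hY.2.2 l (by omega)
    rw [he] at hcov
    obtain ⟨z, hz, hmu⟩ := cover_step h hcov
    obtain ⟨w, hw, hv, hr⟩ := ih (good_step h hz).1
      ⟨fun r hr => hY.1 r (by omega), hY.2.1, fun r hr => hY.2.2 r (by omega)⟩ hmu
    refine ⟨z :: w, by simp [hw], ⟨hz, hv⟩, fun r hr' => ?_⟩
    by_cases h1 : r ≤ l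
    · simp only [chainOf, hw, if_pos h1]; exact hr r h1
    · simp only [chainOf, hw, if_neg h1]
      rw [show r = l + 1 by omega, he]

lemma step_inj {n : ℕ} {g : ℕ → ℕ} (h : Good n g) {z z' : ℕ} (hz : okMove g z)
    (hs : step g z = step g z') : z = z' := by
  by_contra hne
  have := congrFun hs z
  rw [step, step, Function.update_self, Function.update_of_ne hne] at this
  have h1 := h.lt hz.1
  omega

lemma chainOf_inj {n : ℕ} (w : List ℕ) : ∀ {g : ℕ → ℕ} {w' : List ℕ}, Good n g → Valid g w →
    Valid g w' → w.length = w'.length →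
    (∀ r, r ≤ w.length → chainOf n g w r = chainOf n g w' r) → w = w' := by
  induction w with
  | nil =>
    intro g w' _ _ _ hl _
    exact (List.length_eq_zero_iff.1 hl.symm).symm
  | cons z w ih =>
    intro g w' h hv hv' hl hr
    cases w' with
    | nil => simp at hl
    | cons z' w' =>
      have hl' : w.length = w'.length := by simpa using hl
      have hr' : ∀ r, r ≤ w.length →
          chainOf n (step g z) w r = chainOf n (step g z') w' r := by
        intro r hrw
        have := hr r (by simp; omega)
        simpa only [chainOf, ← hl', if_pos hrw] using this
      have he := hr' w.length le_rfl
      rw [chainOf_end, hl', chainOf_end] at he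
      have hs : step g z = step g z' := by
        rw [← (good_step h hv.1).1.2.1, ← (good_step h hv'.1).1.2.1, he]
      have hzz := step_inj h hv.1 hs
      subst hzz
      rw [ih (good_step h hv.1).1 hv.2 hv'.2 hl' hr']


section Chain

variable {Y : ℕ → ℕ → ℕ} {l : ℕ}

lemma chain_step (hY : IsTamariChain Y l) {r : ℕ} (hr : r < l) :
    (∀ x, Y r x ≤ Y (r + 1) x ∧ Y (r + 1) x ≤ Y r x + 1) ∧
      ∃ x, 1 ≤ x ∧ Y r x < Y (r + 1) x := by
  obtain ⟨d, ⟨hd, h1, h2⟩, he⟩ := hY.2.2 r hr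
  have hg := G_spec (Y (r + 1)) hd
  refine ⟨fun x => ?_, d, hd, ?_⟩
  · rw [he, removeStrip_eq _ hd]; split_ifs <;> omega
  · rw [he, removeStrip_eq _ hd, if_pos ⟨hg.1, le_rfl⟩]; omega

lemma chain_mono (hY : IsTamariChain Y l) {r s : ℕ} (hrs : r ≤ s) (hs : s ≤ l) (x : ℕ) :
    Y r x ≤ Y s x := by
  induction s, hrs using Nat.le_induction with
  | base => exact le_rfl
  | succ k hk ih => exact (ih (by omega)).trans ((chain_step hY (by omega)).1 x).1

lemma psi_zero {x y : ℕ} (h : ¬ (1 ≤ x ∧ 1 ≤ y ∧ y ≤ Y l x)) : psiFun Y l (x, y) = 0 := by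
  simp only [psiFun]; rw [if_neg h]

lemma psi_le_iff (hY : IsTamariChain Y l) {x y : ℕ} (h : 1 ≤ x ∧ 1 ≤ y ∧ y ≤ Y l x) {r : ℕ}
    (hr : r ≤ l) : psiFun Y l (x, y) ≤ r ↔ y ≤ Y r x := by
  simp only [psiFun]; rw [if_pos h]
  constructor
  · intro h1
    have hne : ({r | r ≤ l ∧ y ≤ Y r x} : Set ℕ).Nonempty := ⟨l, le_rfl, h.2.2⟩
    have := Nat.sInf_mem hne
    exact this.2.trans (chain_mono hY h1 hr x)
  · intro h1
    exact Nat.sInf_le ⟨hr, h1⟩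

lemma psi_ne (hY : IsTamariChain Y l) {x y : ℕ} :
    psiFun Y l (x, y) ≠ 0 ↔ (1 ≤ x ∧ 1 ≤ y ∧ y ≤ Y l x) := by
  constructor
  · intro h
    by_contra hcon
    exact h (psi_zero hcon)
  · intro h h0
    have := (psi_le_iff hY h (Nat.zero_le l)).1 h0.le
    rw [hY.2.1 x] at this
    omega

lemma psi_le (hY : IsTamariChain Y l) (x y : ℕ) : psiFun Y l (x, y) ≤ l := by
  by_cases h : 1 ≤ x ∧ 1 ≤ y ∧ y ≤ Y l x
  · exact (psi_le_iff hY h le_rfl).2 h.2.2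
  · rw [psi_zero h]; omega

lemma psi_label (hY : IsTamariChain Y l) {v : ℕ} (h1 : 1 ≤ v) (h2 : v ≤ l) :
    ∃ b, psiFun Y l b = v := by
  obtain ⟨x, hx, hlt⟩ := (chain_step hY (r := v - 1) (by omega)).2
  rw [show v - 1 + 1 = v by omega] at hlt
  have hb : 1 ≤ x ∧ 1 ≤ Y v x ∧ Y v x ≤ Y l x := ⟨hx, by omega, chain_mono hY h2 le_rfl x⟩
  refine ⟨(x, Y v x), le_antisymm ((psi_le_iff hY hb h2).2 le_rfl) ?_⟩
  by_contra hcon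
  have := (psi_le_iff hY hb (r := v - 1) (by omega)).1 (by omega)
  omega

lemma psi_tlen (hY : IsTamariChain Y l) : tlen (psiFun Y l) = l := by
  unfold tlen
  apply le_antisymm
  · apply csSup_le'
    rintro v ⟨_, ⟨x, y⟩, rfl⟩
    exact psi_le hY x y
  · rcases Nat.eq_zero_or_pos l with h | h
    · omega
    · apply le_csSup
      · refine ⟨l, ?_⟩
        rintro v ⟨_, ⟨x, y⟩, rfl⟩
        exact psi_le hY x y
      · exact ⟨by omega, psi_label hY h le_rfl⟩

lemma psi_rowLen (hY : IsTamariChain Y l) (x : ℕ) : rowLen (psiFun Y l) x = Y l x := by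
  unfold rowLen
  apply le_antisymm
  · apply csSup_le'
    intro y hy
    exact ((psi_ne hY).1 hy).2.2
  · rcases Nat.eq_zero_or_pos (Y l x) with h | h
    · omega
    · apply le_csSup
      · refine ⟨Y l x, ?_⟩
        intro y hy
        exact ((psi_ne hY).1 hy).2.2
      · refine (psi_ne hY).2 ⟨?_, h, le_rfl⟩
        rcases Nat.eq_zero_or_pos x with rfl | hx
        · rw [(hY.1 l le_rfl).1] at h; omega
        · exact hx

lemma psi_tableau (hY : IsTamariChain Y l) : IsTableau (psiFun Y l) := by
  have hD := hY.1 l le_rfl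
  refine ⟨fun y => psi_zero (by omega), fun x => psi_zero (by omega), ?_, ?_, ?_, ?_, ?_⟩
  · obtain ⟨N, hN⟩ := hD.2.2
    refine Set.Finite.subset ((Set.finite_Iic N).prod (Set.finite_Iic (Y l 1))) ?_
    rintro ⟨x, y⟩ h
    obtain ⟨h1, h2, h3⟩ := (psi_ne hY).1 h
    refine ⟨?_, ?_⟩
    · by_contra hcon
      simp only [Set.mem_Iic, not_le] at hcon
      have := hN x hcon.le
      omega
    · exact h3.trans (diag_pos hD le_rfl h1)
  · intro x y x' y' h1 h2 h3 h4 h5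
    rw [psi_ne hY] at h5 ⊢
    exact ⟨h1, h3, h4.trans (h5.2.2.trans (diag_pos hD h1 h2))⟩
  · intro x y h1 h2
    have hb1 := (psi_ne hY).1 h1
    have hb2 := (psi_ne hY).1 h2
    have hl := psi_le hY x (y + 1)
    set v := psiFun Y l (x, y + 1) with hv
    have e1 := (psi_le_iff hY hb2 hl).1 le_rfl
    have e2 := ((chain_step hY (r := v - 1) (by omega)).1 x).2
    rw [show v - 1 + 1 = v by omega] at e2
    have := (psi_le_iff hY hb1 (r := v - 1) (by omega)).2 (by omega)
    omega
  · intro x y h1 h2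
    have hb1 := (psi_ne hY).1 h1
    have hb2 := (psi_ne hY).1 h2
    have hl := psi_le hY (x + 1) y
    have e1 := (psi_le_iff hY hb2 hl).1 le_rfl
    exact (psi_le_iff hY hb1 hl).2 (e1.trans ((hY.1 _ hl).2.1 x hb1.1))
  · intro v hv
    rw [psi_tlen hY]
    constructor
    · exact psi_label hY hv
    · rintro ⟨⟨x, y⟩, rfl⟩
      exact psi_le hY x y

lemma psi_inj {Y' : ℕ → ℕ → ℕ} (hY : IsTamariChain Y l) (hY' : IsTamariChain Y' l)
    (h : psiFun Y l = psiFun Y' l) {r : ℕ} (hr : r ≤ l) : Y r = Y' r := by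
  have key : ∀ {A B : ℕ → ℕ → ℕ}, IsTamariChain A l → IsTamariChain B l →
      psiFun A l = psiFun B l → ∀ x, A r x ≤ B r x := by
    intro A B hA hB hAB x
    by_contra hcon
    have hx : 1 ≤ x := by
      rcases Nat.eq_zero_or_pos x with rfl | hx
      · rw [(hA.1 r hr).1] at hcon; omega
      · exact hx
    have hb : 1 ≤ x ∧ 1 ≤ A r x ∧ A r x ≤ A l x := ⟨hx, by omega, chain_mono hA hr le_rfl x⟩
    have hb' := (psi_ne hA).2 hb
    rw [hAB, psi_ne hB] at hb'
    have h1 := (psi_le_iff hA hb hr).2 le_rfl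
    rw [hAB, psi_le_iff hB hb' hr] at h1
    omega
  funext x
  exact le_antisymm (key hY hY' h x) (key hY' hY h.symm x)

end Chain

/-- The words of length `l` from state `g`. -/
def words (l : ℕ) (g : ℕ → ℕ) : Set (List ℕ) := {w | w.length = l ∧ Valid g w}

lemma ncard_memC (n l : ℕ) (i : ℤ) (hl : (l : ℤ) = (n : ℤ) + i) :
    Set.ncard {C : ℕ × ℕ → ℕ | MemC i n C} = (words l (g0 n)).ncard := by
  symm
  refine Set.ncard_congr (fun w _ => psiFun (chainOf n (g0 n) w) l) ?_ ?_ ?_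
  · rintro w ⟨rfl, hv⟩
    have hc := chainOf_chain w (good_g0 n) hv
    refine ⟨psi_tableau hc, ⟨_, _, hc, rfl⟩, fun x => ?_, ?_⟩
    · rw [psi_rowLen hc, chainOf_end, lamOf_g0]
    · rw [psi_tlen hc]; exact hl
  · rintro w w' ⟨rfl, hv⟩ ⟨hl', hv'⟩ he
    have hc := chainOf_chain w (good_g0 n) hv
    have hc' := chainOf_chain w' (good_g0 n) hv'
    rw [hl'] at hc'
    exact chainOf_inj w (good_g0 n) hv hv' hl'.symm (fun r hr => psi_inj hc hc' he hr)
  · rintro f ⟨_, ⟨l', Y, hY, rfl⟩, h3, h4⟩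
    rw [psi_tlen hY] at h4
    obtain rfl : l' = l := by omega
    have he : Y l' = lamOf n (g0 n) := by
      rw [lamOf_g0]; funext x; rw [← h3, psi_rowLen hY]
    obtain ⟨w, hw, hv, hr⟩ := chain_exists l' (good_g0 n) hY he
    refine ⟨w, ⟨hw, hv⟩, ?_⟩
    have hc := chainOf_chain w (good_g0 n) hv
    rw [hw] at hc
    funext ⟨x, y⟩
    simp only [psiFun, ← hr l' le_rfl]
    congr 2
    ext r
    simp only [Set.mem_ofPred_eq]
    constructor
    · rintro ⟨a, b⟩; exact ⟨a, by rw [hr r a]; exact b⟩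
    · rintro ⟨a, b⟩; exact ⟨a, by rw [← hr r a]; exact b⟩

/-! ### Counting words -/

lemma words_biUnion (g : ℕ → ℕ) (l : ℕ) (T : Finset ℕ) (c : ℕ → ℕ)
    (hT : ∀ z ∈ T, (words l (step g z)).encard = (c z : ℕ∞)) :
    {w : List ℕ | ∃ z ∈ T, ∃ w' ∈ words l (step g z), w = z :: w'}.encard =
      ((∑ z ∈ T, c z : ℕ) : ℕ∞) := by
  induction T using Finset.induction_on with
  | empty => simp
  | insert a T ha ih =>
    have h1 : {w : List ℕ | ∃ z ∈ insert a T, ∃ w' ∈ words l (step g z), w = z :: w'} =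
        (List.cons a '' words l (step g a)) ∪
          {w : List ℕ | ∃ z ∈ T, ∃ w' ∈ words l (step g z), w = z :: w'} := by
      ext w
      constructor
      · rintro ⟨z, hz, w', hw', rfl⟩
        rcases Finset.mem_insert.1 hz with rfl | hz
        · exact Or.inl ⟨w', hw', rfl⟩
        · exact Or.inr ⟨z, hz, w', hw', rfl⟩
      · rintro (⟨w', hw', rfl⟩ | ⟨z, hz, w', hw', rfl⟩)
        · exact ⟨a, Finset.mem_insert_self _ _, w', hw', rfl⟩
        · exact ⟨z, Finset.mem_insert_of_mem hz, w', hw', rfl⟩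
    rw [h1, Set.encard_union_eq, Function.Injective.encard_image, hT a (Finset.mem_insert_self _ _),
      ih (fun z hz => hT z (Finset.mem_insert_of_mem hz)), Finset.sum_insert ha]
    · push_cast; rfl
    · exact List.cons_injective
    · rw [Set.disjoint_left]
      rintro w ⟨w', hw', rfl⟩ ⟨z, hz, w'', hw'', he⟩
      rw [(List.cons.inj he).1] at ha
      exact ha hz

lemma words_rec {g : ℕ → ℕ} {l : ℕ} (T : Finset ℕ) (c : ℕ → ℕ)
    (hT : ∀ z ∈ T, okMove g z ∧ (words l (step g z)).encard = (c z : ℕ∞))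
    (hT' : ∀ z w, okMove g z → w ∈ words l (step g z) → z ∈ T) :
    (words (l + 1) g).encard = ((∑ z ∈ T, c z : ℕ) : ℕ∞) := by
  rw [← words_biUnion g l T c (fun z hz => (hT z hz).2)]
  congr 1
  ext w
  constructor
  · rintro ⟨hl, hv⟩
    cases w with
    | nil => simp at hl
    | cons z w =>
      have hw : w ∈ words l (step g z) := ⟨by simpa using hl, hv.2⟩
      exact ⟨z, hT' z w hv.1 hw, w, hw, rfl⟩
  · rintro ⟨z, hz, w', hw', rfl⟩
    exact ⟨by simp [hw'.1], (hT z hz).1, hw'.2⟩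

lemma words_short (l : ℕ) : ∀ {g : ℕ → ℕ} (S : Finset ℕ), (∀ z ∈ S, g z ≠ 0) → l < S.card →
    ∀ w, w ∉ words l g := by
  induction l with
  | zero =>
    rintro g S hS hc w ⟨hl, hv⟩
    rw [List.length_eq_zero_iff] at hl
    subst hl
    have hg : g = 0 := hv
    obtain ⟨z, hz⟩ := Finset.card_pos.1 hc
    exact hS z hz (by rw [hg]; rfl)
  | succ l ih =>
    rintro g S hS hc w ⟨hl, hv⟩
    cases w with
    | nil => simp at hl
    | cons z w =>
      refine ih (g := step g z) (S.erase z) ?_ ?_ w ⟨by simpa using hl, hv.2⟩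
      · intro y hy
        rw [step, Function.update_of_ne (Finset.ne_of_mem_erase hy)]
        exact hS y (Finset.mem_of_mem_erase hy)
      · have := Finset.pred_card_le_card_erase (s := S) (a := z)
        omega

lemma words_exact {l : ℕ} {g : ℕ → ℕ} (S : Finset ℕ) (hS : ∀ z ∈ S, g z ≠ 0)
    (hc : S.card = l + 1) {z : ℕ} {w : List ℕ} (hw : w ∈ words l (step g z)) :
    z ∈ S ∧ g (g z) = 0 := by
  by_contra hcon
  refine words_short l (g := step g z) S ?_ (by omega) w hw
  intro y hy
  by_cases hyz : y = z
  · subst hyz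
    rw [step, Function.update_self]
    exact fun h => hcon ⟨hy, h⟩
  · rw [step, Function.update_of_ne hyz]
    exact hS y hy

/-- Rows up to `k` are complete, the others untouched. -/
def stA (n k : ℕ) : ℕ → ℕ := fun z => if k < z ∧ z ≤ n then z - 1 else 0

/-- As `stA`, but row `x` has moved to `x - 2`. -/
def stB (n k x : ℕ) : ℕ → ℕ := fun z =>
  if z = x then x - 2 else if k < z ∧ z ≤ n then z - 1 else 0

/-- As `stA n j`, but row `k + 1` is untouched. -/
def stC (n k j : ℕ) : ℕ → ℕ := fun z =>
  if z = k + 1 then k else if j < z ∧ z ≤ n then z - 1 else 0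

lemma words_zero : (words 0 (0 : ℕ → ℕ)).encard = ((1 : ℕ) : ℕ∞) := by
  have : words 0 (0 : ℕ → ℕ) = {[]} := by
    ext w
    constructor
    · rintro ⟨h, _⟩; exact List.length_eq_zero_iff.1 h
    · rintro rfl; exact ⟨rfl, rfl⟩
  rw [this]; simp

lemma stA_self (n : ℕ) : stA n n = 0 := by
  funext z
  simp only [stA]
  rw [if_neg (by omega)]
  rfl

lemma stA_ok {n k z : ℕ} (hk : 1 ≤ k) (h1 : k < z) (h2 : z ≤ n) : okMove (stA n k) z := by
  unfold okMove stA
  refine ⟨by split_ifs <;> omega, fun y hy => ?_⟩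
  split_ifs <;> omega

lemma stA_step {n k : ℕ} (h2 : k + 1 ≤ n) :
    step (stA n k) (k + 1) = stA n (k + 1) := by
  funext y
  by_cases hy : y = k + 1
  · subst hy
    rw [step, Function.update_self]
    simp only [stA]
    split_ifs <;> omega
  · rw [step, Function.update_of_ne hy]
    simp only [stA]
    split_ifs <;> omega

lemma count_A (n m : ℕ) : ∀ k, 1 ≤ k → k + m = n →
    (words m (stA n k)).encard = ((1 : ℕ) : ℕ∞) := by
  induction m with
  | zero =>
    intro k hk hn
    obtain rfl : k = n := by omega
    rw [stA_self]; exact words_zero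
  | succ m ih =>
    intro k hk hn
    rw [words_rec {k + 1} (fun _ => 1)]
    · simp
    · intro z hz
      rw [Finset.mem_singleton] at hz
      subst hz
      refine ⟨stA_ok hk (by omega) (by omega), ?_⟩
      rw [stA_step (by omega)]
      exact ih (k + 1) (by omega) (by omega)
    · intro z w hz hw
      have := words_exact (Finset.Ioc k n) (fun z hz => by
        rw [Finset.mem_Ioc] at hz
        simp only [stA]; split_ifs <;> omega) (by rw [Nat.card_Ioc]; omega) hw
      rw [Finset.mem_Ioc] at this
      rw [Finset.mem_singleton]
      obtain ⟨h1, h2⟩ := this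
      simp only [stA] at h2
      split_ifs at h2 <;> omega

lemma count_C (n m : ℕ) : ∀ k j, 1 ≤ k → k + 2 ≤ j → j + m = n →
    (words (m + 1) (stC n k j)).encard = ((m + 1 : ℕ) : ℕ∞) := by
  induction m with
  | zero =>
    intro k j hk hkj hn
    rw [words_rec {k + 1} (fun _ => 1)]
    · simp
    · intro z hz
      rw [Finset.mem_singleton] at hz
      subst hz
      refine ⟨?_, ?_⟩
      · unfold okMove stC
        refine ⟨by split_ifs <;> omega, fun y hy => ?_⟩
        split_ifs <;> omega
      · have : step (stC n k j) (k + 1) = stA n j := by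
          funext y
          by_cases hy : y = k + 1
          · subst hy
            rw [step, Function.update_self]
            simp only [stA, stC]
            split_ifs <;> omega
          · rw [step, Function.update_of_ne hy]
            simp only [stA, stC]
            split_ifs <;> omega
        rw [this]
        exact count_A n 0 j (by omega) hn
    · intro z w hz hw
      have := words_exact {k + 1} (fun z hz => by
        rw [Finset.mem_singleton] at hz
        simp only [stC]; split_ifs <;> omega) (by simp) hw
      exact this.1
  | succ m ih =>
    intro k j hk hkj hn
    rw [words_rec {k + 1, j + 1} (fun z => if z = k + 1 then 1 else m + 1)]
    · rw [Finset.sum_pair (by omega), if_pos rfl, if_neg (by omega)]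
      congr 1; omega
    · intro z hz
      rw [Finset.mem_insert, Finset.mem_singleton] at hz
      rcases hz with rfl | rfl
      · refine ⟨?_, ?_⟩
        · unfold okMove stC
          refine ⟨by split_ifs <;> omega, fun y hy => ?_⟩
          split_ifs <;> omega
        · have : step (stC n k j) (k + 1) = stA n j := by
            funext y
            by_cases hy : y = k + 1
            · subst hy
              rw [step, Function.update_self]
              simp only [stA, stC]
              split_ifs <;> omega
            · rw [step, Function.update_of_ne hy]
              simp only [stA, stC]
              split_ifs <;> omega
          rw [this, if_pos rfl]
          exact count_A n (m + 1) j (by omega) hn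
      · refine ⟨?_, ?_⟩
        · unfold okMove stC
          refine ⟨by split_ifs <;> omega, fun y hy => ?_⟩
          split_ifs <;> omega
        · have : step (stC n k j) (j + 1) = stC n k (j + 1) := by
            funext y
            by_cases hy : y = j + 1
            · subst hy
              rw [step, Function.update_self]
              simp only [stC]
              split_ifs <;> omega
            · rw [step, Function.update_of_ne hy]
              simp only [stC]
              split_ifs <;> omega
          rw [this, if_neg (by omega)]
          exact ih k (j + 1) hk (by omega) (by omega)
    · intro z w hz hw
      have := words_exact (insert (k + 1) (Finset.Ioc j n)) (fun z hz => by
        rw [Finset.mem_insert, Finset.mem_Ioc] at hz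
        simp only [stC]; split_ifs <;> omega) (by
          rw [Finset.card_insert_of_notMem (by rw [Finset.mem_Ioc]; omega), Nat.card_Ioc]
          omega) hw
      rw [Finset.mem_insert, Finset.mem_Ioc] at this
      rw [Finset.mem_insert, Finset.mem_singleton]
      obtain ⟨h1, h2⟩ := this
      simp only [stC] at h2
      split_ifs at h2 <;> omega

lemma count_B (n t : ℕ) : ∀ k m x, 1 ≤ k → k + 2 + t = x → x ≤ n → k + m = n →
    (words m (stB n k x)).encard = ((n - x + 1 : ℕ) : ℕ∞) := by
  induction t with
  | zero =>
    intro k m x hk hx hxn hm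
    obtain ⟨p, rfl⟩ : ∃ p, m = p + 1 := ⟨m - 1, by omega⟩
    rw [words_rec {x} (fun _ => n - x + 1)]
    · simp
    · intro z hz
      rw [Finset.mem_singleton] at hz
      subst hz
      refine ⟨?_, ?_⟩
      · unfold okMove stB
        refine ⟨by split_ifs <;> omega, fun y hy => ?_⟩
        split_ifs <;> omega
      · have : step (stB n k z) z = stC n k z := by
          funext y
          by_cases hy : y = z
          · subst hy
            rw [step, Function.update_self]
            simp only [stB, stC]
            split_ifs <;> omega
          · rw [step, Function.update_of_ne hy]
            simp only [stB, stC]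
            split_ifs <;> omega
        rw [this, show p = (n - z) + 1 by omega]
        exact count_C n (n - z) k z hk (by omega) (by omega)
    · intro z w hz hw
      have := words_exact (Finset.Ioc k n) (fun z hz => by
        rw [Finset.mem_Ioc] at hz
        simp only [stB]; split_ifs <;> omega) (by rw [Nat.card_Ioc]; omega) hw
      rw [Finset.mem_Ioc] at this
      rw [Finset.mem_singleton]
      obtain ⟨h1, h2⟩ := this
      by_contra hne
      have hz' : z = k + 1 := by
        simp only [stB] at h2
        split_ifs at h2 <;> omega
      have := hz.2 x (by omega)
      simp only [stB] at this
      split_ifs at this <;> omega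
  | succ t ih =>
    intro k m x hk hx hxn hm
    obtain ⟨p, rfl⟩ : ∃ p, m = p + 1 := ⟨m - 1, by omega⟩
    rw [words_rec {k + 1} (fun _ => n - x + 1)]
    · simp
    · intro z hz
      rw [Finset.mem_singleton] at hz
      subst hz
      refine ⟨?_, ?_⟩
      · unfold okMove stB
        refine ⟨by split_ifs <;> omega, fun y hy => ?_⟩
        split_ifs <;> omega
      · have : step (stB n k x) (k + 1) = stB n (k + 1) x := by
          funext y
          by_cases hy : y = k + 1
          · subst hy
            rw [step, Function.update_self]
            simp only [stB]
            split_ifs <;> omega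
          · rw [step, Function.update_of_ne hy]
            simp only [stB]
            split_ifs <;> omega
        rw [this]
        exact ih (k + 1) p x (by omega) (by omega) hxn (by omega)
    · intro z w hz hw
      have := words_exact (Finset.Ioc k n) (fun z hz => by
        rw [Finset.mem_Ioc] at hz
        simp only [stB]; split_ifs <;> omega) (by rw [Nat.card_Ioc]; omega) hw
      rw [Finset.mem_Ioc] at this
      rw [Finset.mem_singleton]
      obtain ⟨h1, h2⟩ := this
      simp only [stB] at h2
      split_ifs at h2 <;> omega

lemma sum_aux (a p : ℕ) : ∑ z ∈ Finset.Ioc a (a + p), (a + p - z + 1) = (p + 1).choose 2 := by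
  have h1 : ∑ z ∈ Finset.Ioc a (a + p), (a + p - z + 1) = ∑ i ∈ Finset.range p, (i + 1) := by
    refine Finset.sum_nbij' (fun z => a + p - z) (fun i => a + p - i) ?_ ?_ ?_ ?_ ?_
    · intro z hz; rw [Finset.mem_Ioc] at hz; rw [Finset.mem_range]; omega
    · intro z hz; rw [Finset.mem_range] at hz; rw [Finset.mem_Ioc]; omega
    · intro z hz; rw [Finset.mem_Ioc] at hz; omega
    · intro z hz; rw [Finset.mem_range] at hz; omega
    · intro z hz; rfl
  rw [h1]
  clear h1
  induction p with
  | zero => rfl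
  | succ p ih =>
    rw [Finset.sum_range_succ, ih, Nat.choose_succ_succ' (p + 1) 1, Nat.choose_one_right, add_comm]

lemma count_A' (n m : ℕ) : ∀ k, 1 ≤ k → k + m = n →
    (words (m + 1) (stA n k)).encard = (((m + 1).choose 3 : ℕ) : ℕ∞) := by
  induction m with
  | zero =>
    intro k hk hn
    obtain rfl : k = n := by omega
    rw [stA_self, words_rec ∅ (fun _ => 0)]
    · rfl
    · simp
    · intro z w hz
      have := hz.1
      simp at this
  | succ m ih =>
    intro k hk hn
    have hins : Finset.Ioc k n = insert (k + 1) (Finset.Ioc (k + 1) n) := by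
      ext z
      simp only [Finset.mem_insert, Finset.mem_Ioc]
      omega
    have hmem : k + 1 ∉ Finset.Ioc (k + 1) n := by simp
    rw [words_rec (Finset.Ioc k n) (fun z => if z = k + 1 then (m + 1).choose 3 else n - z + 1)]
    · rw [hins, Finset.sum_insert hmem, if_pos rfl]
      have : ∑ z ∈ Finset.Ioc (k + 1) n, (if z = k + 1 then (m + 1).choose 3 else n - z + 1) =
          (m + 1).choose 2 := by
        rw [← sum_aux (k + 1) m, show k + 1 + m = n by omega]
        apply Finset.sum_congr rfl
        intro z hz
        rw [Finset.mem_Ioc] at hz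
        rw [if_neg (by omega)]
      rw [this, Nat.choose_succ_succ' (m + 1) 2, add_comm]
    · intro z hz
      rw [Finset.mem_Ioc] at hz
      refine ⟨stA_ok hk hz.1 hz.2, ?_⟩
      by_cases hzk : z = k + 1
      · subst hzk
        rw [if_pos rfl, stA_step (by omega)]
        exact ih (k + 1) (by omega) (by omega)
      · rw [if_neg hzk]
        have : step (stA n k) z = stB n k z := by
          funext y
          by_cases hy : y = z
          · subst hy
            rw [step, Function.update_self]
            simp only [stA, stB]
            split_ifs <;> omega
          · rw [step, Function.update_of_ne hy]
            simp only [stA, stB]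
            split_ifs <;> omega
        rw [this]
        exact count_B n (z - (k + 2)) k (m + 1) z hk (by omega) hz.2 hn
    · intro z w hz hw
      have := hz.1
      simp only [stA] at this
      rw [Finset.mem_Ioc]
      split_ifs at this <;> omega

lemma g0_eq (n : ℕ) : g0 n = stA n 1 := by
  funext z
  simp only [g0, stA]
  split_ifs <;> omega

/-- For all `n ≥ 1`, the number of maximal chains of length `n - 1` in the Tamari lattice `T_n`
is `#C_{-1}(n) = 1`, and the number of maximal chains of length `n` is `#C_0(n) = C(n, 3)`. -/
theorem count_short_chains (n : ℕ) (hn : 1 ≤ n) :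
    Set.ncard {C : ℕ × ℕ → ℕ | MemC (-1) n C} = 1 ∧
    Set.ncard {C : ℕ × ℕ → ℕ | MemC 0 n C} = n.choose 3 := by
  constructor
  · rw [ncard_memC n (n - 1) (-1) (by omega), Set.ncard, g0_eq,
      count_A n (n - 1) 1 le_rfl (by omega)]
    simp
  · rw [ncard_memC n n 0 (by omega), Set.ncard, g0_eq]
    have := count_A' n (n - 1) 1 le_rfl (by omega)
    rw [show n - 1 + 1 = n by omega] at this
    rw [this]
    simp

end TamariMaxChains
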